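/- Let D=(V,A) be a connected, non-strong semicomplete multipartite digraph with linear decomposition R_1,…,R_k, and let x ∈ R_i and y ∈ R_j with i < j. Then D contains an (x,y)-quasi-Hamiltonian path if and only if R_i ∪ R_{i+1} ∪ … ∪ R_j intersects every color class of D. -/

import Mathlib

open Set

variable {V : Type*}

/-- `p` is a directed path (nonempty, vertices pairwise distinct, consecutive
vertices joined by arcs of `A`) all of whose vertices lie in `S`. -/
def IsPathOn (A : V → V → Prop) (S : Set V) (p : List V) : Prop :=
  p ≠ [] ∧ p.Nodup ∧ p.Chain' A ∧ ∀ v ∈ p, v ∈ S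

/-- `p` is a directed path within `S` starting at `x` and ending at `y`. -/
def IsPathFromTo (A : V → V → Prop) (S : Set V) (p : List V) (x y : V) : Prop :=
  IsPathOn A S p ∧ p.head? = some x ∧ p.getLast? = some y

/-- The subdigraph induced on `S` is strong. -/
def StrongOn (A : V → V → Prop) (S : Set V) : Prop :=
  ∀ x ∈ S, ∀ y ∈ S, x ≠ y → ∃ p, IsPathFromTo A S p x y

/-- The subdigraph induced on `S` is `k`-strong: it has at least `k+1` vertices and
remains strong after deleting any set of at most `k-1` vertices. -/
def KStrongOn (A : V → V → Prop) (k : ℕ) (S : Set V) : Prop :=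
  k + 1 ≤ S.ncard ∧ ∀ X : Set V, X ⊆ S → X.ncard ≤ k - 1 → StrongOn A (S \ X)

/-- In a semicomplete multipartite digraph, two vertices lie in the same color class
iff they are equal or there is no arc between them in either direction. -/
def SameClass (A : V → V → Prop) (u v : V) : Prop :=
  u = v ∨ (¬ A u v ∧ ¬ A v u)

/-- `A` is (the arc relation of) a semicomplete multipartite digraph: it is loopless
and the "same color class" relation is transitive (hence an equivalence relation whose
classes are the color classes: within a class there are no arcs, and between any two
vertices of different classes there is at least one arc). -/
def IsSMD (A : V → V → Prop) : Prop :=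
  (∀ v, ¬ A v v) ∧
  ∀ u v w, SameClass A u v → SameClass A v w → SameClass A u w

/-- A digraph is unilaterally connected if any two distinct vertices are joined by a
directed path in one direction or the other. -/
def Unilateral (A : V → V → Prop) : Prop :=
  ∀ x y : V, x ≠ y →
    (∃ p, IsPathFromTo A Set.univ p x y) ∨ (∃ p, IsPathFromTo A Set.univ p y x)

/-- The independence number of a semicomplete multipartite digraph: the maximum size
of a color class. -/
noncomputable def indepNum [Fintype V] (A : V → V → Prop) : ℕ :=
  Finset.univ.sup fun v : V => {u | SameClass A v u}.ncard

/-- `X` is a 2-separator of `x` and `y`: at most two vertices, avoiding `x` and `y`,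
whose removal destroys all `(x,y)`-paths. -/
def IsTwoSep (A : V → V → Prop) (x y : V) (X : Set V) : Prop :=
  X ⊆ ({x, y} : Set V)ᶜ ∧ X.ncard ≤ 2 ∧ ¬ ∃ p, IsPathFromTo A Xᶜ p x y

/-- A separator of `x` and `y` is trivial if it contains all out-neighbors of `x`
or all in-neighbors of `y`. -/
def IsTrivialSep (A : V → V → Prop) (x y : V) (X : Set V) : Prop :=
  {w | A x w} ⊆ X ∨ {w | A w y} ⊆ X

/-- `T` is a strong component of the subdigraph induced on `S`: a maximal subset of
`S` inducing a strong subdigraph. -/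
def IsStrongComponentOn (A : V → V → Prop) (S T : Set V) : Prop :=
  T ⊆ S ∧ StrongOn A T ∧ ∀ U : Set V, T ⊆ U → U ⊆ S → StrongOn A U → U = T

/-- `R 0, …, R (k-1)` is the linear decomposition of the subdigraph induced on `S`:
an ordered partition of `S` into nonempty sets, each of which is a strong component
of the subdigraph induced on `S` or a subset of a single color class, with no arc
from a later part to an earlier one and at least one arc between consecutive parts. -/
def IsLinearDecompOn (A : V → V → Prop) (S : Set V) (k : ℕ) (R : Fin k → Set V) : Prop :=
  (∀ i, (R i).Nonempty ∧ R i ⊆ S) ∧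
  (∀ v ∈ S, ∃! i, v ∈ R i) ∧
  (∀ i, IsStrongComponentOn A S (R i) ∨ ∃ v, R i ⊆ {u | SameClass A v u}) ∧
  (∀ i j : Fin k, i < j → ∀ a ∈ R j, ∀ b ∈ R i, ¬ A a b) ∧
  (∀ i : Fin k, ∀ h : (i : ℕ) + 1 < k, ∃ a ∈ R i, ∃ b ∈ R ⟨(i : ℕ) + 1, h⟩, A a b)

/-- The digraph with arc relation `B` contains a directed cycle. -/
def HasCycle (B : V → V → Prop) : Prop :=
  ∃ c : List V, 2 ≤ c.length ∧ c.Nodup ∧ c.Chain' B ∧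
    ∃ a b, c.head? = some a ∧ c.getLast? = some b ∧ B b a

open Relation

namespace SMD

theorem _root_.SameClass.symm {A : V → V → Prop} {u v : V} (h : SameClass A u v) : SameClass A v u := by
  rcases h with h | h
  · exact Or.inl h.symm
  · exact Or.inr ⟨h.2, h.1⟩

theorem adj_of_not_sameClass {A : V → V → Prop} {u v : V} (h : ¬ SameClass A u v) :
    A u v ∨ A v u := by
  unfold SameClass at h
  tauto

theorem reflTransGen_of_mem_isChain {A : V → V → Prop} {p : List V} {x u : V}
    (hp : p.IsChain A) (hx : p.head? = some x) (hu : u ∈ p) : ReflTransGen A x u := by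
  induction p generalizing x with
  | nil => simp at hu
  | cons a t ih =>
    obtain rfl : a = x := by simpa using hx
    rcases List.mem_cons.1 hu with rfl | hu
    · exact .refl
    · cases t with
      | nil => simp at hu
      | cons b t =>
        rw [List.isChain_cons_cons] at hp
        exact .head hp.1 (ih hp.2 rfl hu)

/-- A vertex outside `p` that is reachable from a vertex of `p` is reached by a path
meeting `p` only in its first vertex. -/
theorem exists_ear {A : V → V → Prop} {p : List V} {x v : V}
    (hx : x ∈ p) (hxv : ReflTransGen A x v) (hv : v ∉ p) :
    ∃ a ∈ p, ∃ q : List V, (a :: (q ++ [v])).IsChain A ∧ (q ++ [v]).Nodup ∧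
      ∀ u ∈ q ++ [v], u ∉ p := by
  induction hxv with
  | refl => exact absurd hx hv
  | @tail u v _ huv ih =>
    by_cases hu : u ∈ p
    · exact ⟨u, hu, [], by simpa using huv, by simp, by simpa using hv⟩
    obtain ⟨a, ha, q, hc, hn, hd⟩ := ih hu
    refine ⟨a, ha, ?_⟩
    by_cases hvq : v ∈ q ++ [u]
    · obtain ⟨s, t, hst⟩ := List.append_of_mem hvq
      rw [hst] at hc hn hd
      have e : s ++ v :: t = (s ++ [v]) ++ t := by simp
      rw [e] at hc hn hd
      refine ⟨s, ?_, hn.of_append_left, fun w hw => hd w (List.mem_append_left _ hw)⟩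
      rw [← List.cons_append] at hc
      exact hc.left_of_append
    · refine ⟨q ++ [u], ?_, ?_, ?_⟩
      · rw [← List.cons_append, List.isChain_append]
        refine ⟨hc, by simp, ?_⟩
        simpa [List.getLast?_cons] using huv
      · rw [List.nodup_append]
        refine ⟨hn, by simp, ?_⟩
        rintro b hb c hc rfl
        exact hvq (List.mem_singleton.1 hc ▸ hb)
      · intro w hw
        rcases List.mem_append.1 hw with hw | hw
        · exact hd w hw
        · rwa [List.mem_singleton.1 hw]

/-- Inserting the internally disjoint path `q` between two consecutive vertices of a path. -/
theorem isPathFromTo_insert {A : V → V → Prop} {l r q : List V} {a b x y : V}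
    (hp : IsPathFromTo A univ (l ++ a :: b :: r) x y) (hc : (a :: (q ++ [b])).IsChain A)
    (hn : q.Nodup) (hd : ∀ u ∈ q, u ∉ l ++ a :: b :: r) :
    IsPathFromTo A univ (l ++ a :: (q ++ b :: r)) x y := by
  obtain ⟨⟨-, hpn, hpc, -⟩, hh, hl⟩ := hp
  refine ⟨⟨by simp, ?_, ?_, fun _ _ => mem_univ _⟩, ?_, ?_⟩
  · have : (l ++ a :: (q ++ b :: r)).Perm (q ++ (l ++ a :: b :: r)) := by
      have e : l ++ a :: (q ++ b :: r) = (l ++ [a]) ++ q ++ (b :: r) := by simp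
      have e' : q ++ (l ++ a :: b :: r) = q ++ (l ++ [a]) ++ (b :: r) := by simp
      rw [e, e']
      exact List.perm_append_comm.append_right _
    rw [this.nodup_iff, List.nodup_append]
    exact ⟨hn, hpn, fun u hu w hw h => hd u hu (h ▸ hw)⟩
  · have hpc : (l ++ a :: b :: r).IsChain A := hpc
    rw [List.isChain_split] at hpc
    have e : a :: (q ++ b :: r) = (a :: q) ++ b :: r := by simp
    show List.IsChain A _
    rw [List.isChain_split, e]
    exact ⟨hpc.1, List.isChain_split.2 ⟨by simpa using hc, (List.isChain_cons_cons.1 hpc.2).2⟩⟩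
  · cases l <;> simpa using hh
  · simpa [List.getLast?_append, List.getLast?_cons] using hl

theorem isPathFromTo_reverse {A : V → V → Prop} {p : List V} {x y : V}
    (hp : IsPathFromTo A univ p x y) : IsPathFromTo (flip A) univ p.reverse y x := by
  obtain ⟨⟨h0, hn, hc, -⟩, hh, hl⟩ := hp
  refine ⟨⟨by simpa using h0, List.nodup_reverse.2 hn, ?_, fun _ _ => mem_univ _⟩, ?_, ?_⟩
  · exact List.isChain_reverse.2 hc
  · simpa using hl
  · simpa using hh

theorem exists_isPathFromTo {A : V → V → Prop} {x y : V} (h : ReflTransGen A x y) :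
    ∃ p, IsPathFromTo A univ p x y := by
  by_cases hxy : y = x
  · exact ⟨[x], ⟨by simp, by simp, List.isChain_singleton x, by simp⟩, by simp, by simp [hxy]⟩
  obtain ⟨a, ha, q, hc, hn, hd⟩ := exists_ear (p := [x]) (by simp) h (by simpa using hxy)
  obtain rfl : a = x := by simpa using ha
  refine ⟨a :: (q ++ [y]), ⟨by simp, ?_, hc, fun _ _ => mem_univ _⟩, by simp,
    by simp [List.getLast?_cons]⟩
  exact List.nodup_cons.2 ⟨fun h => hd a h (by simp), hn⟩

/-- A vertex dominating a whole path and reachable from its start can be absorbed by the path. -/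
theorem exists_path_superset_of_dominating {A : V → V → Prop} {p : List V} {x y v : V}
    (hp : IsPathFromTo A univ p x y) (hyx : ¬ ReflTransGen A y x) (hxv : ReflTransGen A x v)
    (hv : v ∉ p) (hdom : ∀ u ∈ p, A v u) :
    ∃ p', IsPathFromTo A univ p' x y ∧ p ⊆ p' ∧ v ∈ p' := by
  have hxp : x ∈ p := List.mem_of_mem_head? hp.2.1
  obtain ⟨a, ha, q, hc, hn, hd⟩ := exists_ear hxp hxv hv
  obtain ⟨l, r, rfl⟩ := List.append_of_mem ha
  cases r with
  | nil =>
    obtain rfl : a = y := by simpa using hp.2.2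
    exact absurd ((reflTransGen_of_mem_isChain hc rfl (by simp)).tail (hdom x hxp)) hyx
  | cons b r =>
    refine ⟨_, isPathFromTo_insert hp (q := q ++ [v]) ?_ hn hd, ?_, by simp⟩
    · rw [← List.cons_append, List.isChain_append]
      refine ⟨hc, by simp, ?_⟩
      simpa [List.getLast?_cons] using hdom b (by simp)
    · intro w hw
      simp only [List.mem_append, List.mem_cons] at hw ⊢
      tauto

/-- A vertex adjacent to every vertex of a path either fits between two consecutive vertices,
or is dominated by the whole path, or dominates exactly the
vertices of a nonempty initial segment. -/
theorem insertable_or_dominated_or_dominating_prefix {A : V → V → Prop} {v : V} (p : List V)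
    (hadj : ∀ u ∈ p, A u v ∨ A v u) :
    (∃ l a b r, p = l ++ a :: b :: r ∧ A a v ∧ A v b) ∨ (∀ u ∈ p, A u v) ∨
      ∃ l r, p = l ++ r ∧ l ≠ [] ∧ (∀ u ∈ l, A v u) ∧ ∀ u ∈ r, A u v := by
  induction p with
  | nil => simp
  | cons c t ih =>
    rcases ih fun u hu => hadj u (List.mem_cons_of_mem _ hu) with
      ⟨l, a, b, r, rfl, h⟩ | h | ⟨l, r, rfl, h0, h1, h2⟩
    · exact Or.inl ⟨c :: l, a, b, r, rfl, h⟩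
    · rcases hadj c (by simp) with hc | hc
      · exact Or.inr (Or.inl (by simpa using ⟨hc, h⟩))
      · exact Or.inr (Or.inr ⟨[c], t, rfl, by simp, by simpa using hc, h⟩)
    · rcases hadj c (by simp) with hc | hc
      · obtain ⟨b, l, rfl⟩ := List.exists_cons_of_ne_nil h0
        exact Or.inl ⟨[], c, b, l ++ r, rfl, hc, h1 b (by simp)⟩
      · exact Or.inr (Or.inr ⟨c :: l, r, rfl, by simp, by simpa using ⟨hc, h1⟩, h2⟩)

/-- A vertex adjacent to every vertex of an `(x,y)`-path, reachable from `x` and reaching `y`,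
can be absorbed by the path, provided that `y` does not reach `x`. -/
theorem exists_path_superset {A : V → V → Prop} {p : List V} {x y v : V}
    (hp : IsPathFromTo A univ p x y) (hyx : ¬ ReflTransGen A y x) (hxv : ReflTransGen A x v)
    (hvy : ReflTransGen A v y) (hv : v ∉ p) (hadj : ∀ u ∈ p, A u v ∨ A v u) :
    ∃ p', IsPathFromTo A univ p' x y ∧ p ⊆ p' ∧ v ∈ p' := by
  rcases insertable_or_dominated_or_dominating_prefix p hadj with
    ⟨l, a, b, r, rfl, hav, hvb⟩ | h | ⟨l, r, rfl, h0, h1, h2⟩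
  · refine ⟨_, isPathFromTo_insert hp (q := [v]) (by simp [hav, hvb]) (by simp) (by simpa using hv),
      ?_, by simp⟩
    intro w hw
    simp only [List.mem_append, List.mem_cons] at hw ⊢
    tauto
  · obtain ⟨p', hp', hs, hvp⟩ := exists_path_superset_of_dominating (isPathFromTo_reverse hp)
      (fun h => hyx (reflTransGen_swap.1 h)) (reflTransGen_swap.2 hvy) (by simpa using hv)
      (fun u hu => h u (List.mem_reverse.1 hu))
    exact ⟨p'.reverse, isPathFromTo_reverse hp',
      fun w hw => List.mem_reverse.2 (hs (List.mem_reverse.2 hw)), List.mem_reverse.2 hvp⟩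
  · have hvx : A v x := by
      obtain ⟨b, l, rfl⟩ := List.exists_cons_of_ne_nil h0
      obtain rfl : b = x := by simpa using hp.2.1
      exact h1 b (by simp)
    obtain rfl : r = [] := by
      by_contra hr
      have hy : y ∈ r := by
        have := hp.2.2
        rw [List.getLast?_append_of_ne_nil _ hr] at this
        exact List.mem_of_getLast? this
      exact hyx ((ReflTransGen.single (h2 y hy)).tail hvx)
    exact exists_path_superset_of_dominating hp hyx hxv hv (by simpa using h1)

theorem exists_path_meeting_classes {A : V → V → Prop} {x y : V} (hxy : ReflTransGen A x y)
    (hyx : ¬ ReflTransGen A y x) (s : Finset V)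
    (hs : ∀ v ∈ s, ReflTransGen A x v ∧ ReflTransGen A v y) :
    ∃ p, IsPathFromTo A univ p x y ∧ ∀ v ∈ s, ∃ u ∈ p, SameClass A u v := by
  classical
  induction s using Finset.induction_on with
  | empty => simpa using exists_isPathFromTo hxy
  | insert v s _ ih =>
    obtain ⟨p, hp, hps⟩ := ih fun u hu => hs u (Finset.mem_insert_of_mem hu)
    by_cases h : ∃ u ∈ p, SameClass A u v
    · exact ⟨p, hp, by simpa using ⟨h, hps⟩⟩
    · push Not at h
      obtain ⟨hxv, hvy⟩ := hs v (Finset.mem_insert_self _ _)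
      obtain ⟨p', hp', hsub, hv⟩ := exists_path_superset hp hyx hxv hvy
        (fun hv => h v hv (Or.inl rfl)) (fun u hu => adj_of_not_sameClass (h u hu))
      refine ⟨p', hp', fun w hw => ?_⟩
      rcases Finset.mem_insert.1 hw with rfl | hw
      · exact ⟨w, hv, Or.inl rfl⟩
      · obtain ⟨u, hu, huw⟩ := hps w hw
        exact ⟨u, hsub hu, huw⟩

section Decomposition

variable {A : V → V → Prop} {k : ℕ} {R : Fin k → Set V}

theorem part_le_of_arc (hR : IsLinearDecompOn A univ k R) {a b : V} {m n : Fin k}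
    (ha : a ∈ R m) (hb : b ∈ R n) (hab : A a b) : m ≤ n :=
  not_lt.1 fun h => hR.2.2.2.1 n m h a ha b hb hab

theorem part_le_of_reflTransGen (hR : IsLinearDecompOn A univ k R) {a b : V} {m n : Fin k}
    (ha : a ∈ R m) (hb : b ∈ R n) (hab : ReflTransGen A a b) : m ≤ n := by
  induction hab generalizing n with
  | refl => exact ((hR.2.1 a (mem_univ a)).unique ha hb).le
  | @tail u w _ huw ih =>
    obtain ⟨l, hl, -⟩ := hR.2.1 u (mem_univ u)
    exact (ih hl).trans (part_le_of_arc hR hl hb huw)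

theorem arc_of_part_lt (hR : IsLinearDecompOn A univ k R) {a b : V} {m n : Fin k}
    (ha : a ∈ R m) (hb : b ∈ R n) (hmn : m < n) (h : ¬ SameClass A a b) : A a b :=
  (adj_of_not_sameClass h).resolve_right (hR.2.2.2.1 m n hmn b hb a ha)

theorem sameClass_or_reflTransGen (hA : IsSMD A) (hR : IsLinearDecompOn A univ k R)
    {a b : V} {m : Fin k} (ha : a ∈ R m) (hb : b ∈ R m) :
    ReflTransGen A a b ∨ ∀ u ∈ R m, ∀ w ∈ R m, SameClass A u w := by
  rcases hR.2.2.1 m with h | ⟨v, hv⟩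
  · left
    by_cases hab : a = b
    · exact hab ▸ .refl
    · obtain ⟨p, hp, hh, hl⟩ := h.2.1 a ha b hb hab
      exact reflTransGen_of_mem_isChain hp.2.2.1 hh (List.mem_of_getLast? hl)
  · exact Or.inr fun u hu w hw => hA.2 u v w (hv hu).symm (hv hw)

theorem reflTransGen_of_part_lt (hA : IsSMD A) (hR : IsLinearDecompOn A univ k R)
    {a b : V} {m n : Fin k} (ha : a ∈ R m) (hb : b ∈ R n) (hmn : m < n) :
    ReflTransGen A a b := by
  by_cases hab : SameClass A a b
  swap
  · exact .single (arc_of_part_lt hR ha hb hmn hab)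
  have hm : (m : ℕ) + 1 < k := by have := n.2; have : (m : ℕ) < n := hmn; omega
  obtain ⟨u, hu, w, hw, huw⟩ := hR.2.2.2.2 m hm
  have huw' : ¬ SameClass A u w := by
    rintro (rfl | h)
    · exact hA.1 _ huw
    · exact h.1 huw
  by_cases haw : SameClass A a w
  · have hau : ¬ SameClass A u a := fun h => huw' (hA.2 _ _ _ h haw)
    rcases sameClass_or_reflTransGen hA hR ha hu with h | h
    · exact h.tail (arc_of_part_lt hR hu hb hmn fun h => hau (hA.2 _ _ _ h hab.symm))
    · exact absurd (h u hu a ha) hau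
  · have h1 : A a w := arc_of_part_lt hR ha hw (Fin.lt_def.2 (Nat.lt_succ_self _)) haw
    have hwb : ¬ SameClass A w b := fun h => haw (hA.2 _ _ _ hab h.symm)
    have hle : (⟨(m : ℕ) + 1, hm⟩ : Fin k) ≤ n := Fin.le_def.2 (Nat.succ_le_of_lt hmn)
    rcases hle.lt_or_eq with hlt | rfl
    · exact .tail (.single h1) (arc_of_part_lt hR hw hb hlt hwb)
    · rcases sameClass_or_reflTransGen hA hR hw hb with h | h
      · exact .head h1 h
      · exact absurd (h w hw b hb) hwb

/-- Every color class met by the parts between those of `x` and `y` contains a vertex which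
is reachable from `x` and reaches `y`. -/
theorem exists_sameClass_between (hA : IsSMD A) (hR : IsLinearDecompOn A univ k R)
    {x y u : V} {i j m : Fin k} (hx : x ∈ R i) (hy : y ∈ R j) (hij : i < j)
    (hu : u ∈ R m) (him : i ≤ m) (hmj : m ≤ j) :
    ∃ w, SameClass A w u ∧ ReflTransGen A x w ∧ ReflTransGen A w y := by
  rcases him.lt_or_eq with him | rfl
  · have hxu := reflTransGen_of_part_lt hA hR hx hu him
    rcases hmj.lt_or_eq with hmj | rfl
    · exact ⟨u, Or.inl rfl, hxu, reflTransGen_of_part_lt hA hR hu hy hmj⟩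
    · rcases sameClass_or_reflTransGen hA hR hu hy with h | h
      · exact ⟨u, Or.inl rfl, hxu, h⟩
      · exact ⟨y, h y hy u hu, reflTransGen_of_part_lt hA hR hx hy hij, .refl⟩
  · rcases sameClass_or_reflTransGen hA hR hx hu with h | h
    · exact ⟨u, Or.inl rfl, h, reflTransGen_of_part_lt hA hR hu hy hij⟩
    · exact ⟨x, h x hx u hu, .refl, reflTransGen_of_part_lt hA hR hx hy hij⟩

end Decomposition

end SMD

/-- Let `D` be a connected, non-strong SMD with linear decomposition
`R 0, …, R (k-1)`, and let `x ∈ R i`, `y ∈ R j` with `i < j`. Then `D` has an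
`(x,y)`-quasi-Hamiltonian path iff `R i ∪ … ∪ R j` meets every color class of `D`. -/
theorem stmt_13 {V : Type*} [Fintype V] (A : V → V → Prop) (hSMD : IsSMD A)
    (hconn : ∀ u v : V, Relation.ReflTransGen (fun a b => A a b ∨ A b a) u v)
    (hnotstrong : ¬ StrongOn A (Set.univ : Set V))
    (k : ℕ) (R : Fin k → Set V) (hR : IsLinearDecompOn A Set.univ k R)
    (x y : V) (i j : Fin k) (hx : x ∈ R i) (hy : y ∈ R j) (hij : i < j) :
    (∃ p : List V, IsPathFromTo A Set.univ p x y ∧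
        ∀ v : V, ∃ u ∈ p, SameClass A u v) ↔
      ∀ v : V, ∃ m : Fin k, i ≤ m ∧ m ≤ j ∧ ∃ u ∈ R m, SameClass A u v := by
  classical
  constructor
  · rintro ⟨p, ⟨⟨-, hpn, hpc, -⟩, hh, hl⟩, hp⟩ v
    obtain ⟨u, hu, huv⟩ := hp v
    obtain ⟨m, hm, -⟩ := hR.2.1 u (mem_univ u)
    have hpc : p.IsChain A := hpc
    have huy : Relation.ReflTransGen A u y := by
      obtain ⟨l, r, rfl⟩ := List.append_of_mem hu
      refine SMD.reflTransGen_of_mem_isChain (p := u :: r) hpc.right_of_append rfl ?_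
      rw [List.getLast?_append_of_ne_nil _ (by simp)] at hl
      exact List.mem_of_getLast? hl
    exact ⟨m, SMD.part_le_of_reflTransGen hR hx hm (SMD.reflTransGen_of_mem_isChain hpc hh hu),
      SMD.part_le_of_reflTransGen hR hm hy huy, u, hm, huv⟩
  · intro h
    obtain ⟨p, hp, hps⟩ := SMD.exists_path_meeting_classes
      (SMD.reflTransGen_of_part_lt hSMD hR hx hy hij)
      (fun hyx => (SMD.part_le_of_reflTransGen hR hy hx hyx).not_gt hij)
      (Finset.univ.filter fun v => Relation.ReflTransGen A x v ∧ Relation.ReflTransGen A v y)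
      (by simp)
    refine ⟨p, hp, fun v => ?_⟩
    obtain ⟨m, him, hmj, u, hu, huv⟩ := h v
    obtain ⟨w, hwu, hw⟩ := SMD.exists_sameClass_between hSMD hR hx hy hij hu him hmj
    obtain ⟨z, hz, hzw⟩ := hps w (by simpa using hw)
    exact ⟨z, hz, hSMD.2 _ _ _ hzw (hSMD.2 _ _ _ hwu huv)⟩
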